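/- Let k be a field, Ω a nonzero commutative k-algebra, R a commutative k-algebra, and X a scheme over k. Then the map sending a k-morphism f : Spec R → X to the composite of f with the morphism Spec(R ⊗_k Ω) → Spec R induced by the k-algebra homomorphism r ↦ r ⊗ 1 is an injective map from the set of k-morphisms Spec R → X to the set of k-morphisms Spec(R ⊗_k Ω) → X. -/

import Mathlib

universe u

open AlgebraicGeometry CategoryTheory TensorProduct in
/-- For a field `k`, a nonzero commutative `k`-algebra `Ω`, a commutative
`k`-algebra `R` and a scheme `X` over `k`, composing a `k`-morphism `Spec R ⟶ X` with
the morphism `Spec (R ⊗[k] Ω) ⟶ Spec R` induced by `r ↦ r ⊗ 1` is injective. -/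
theorem stmt_0 (k : Type u) [Field k] (Ω : Type u) [CommRing Ω] [Algebra k Ω]
    [Nontrivial Ω] (R : Type u) [CommRing R] [Algebra k R] (X : Scheme.{u})
    (fX : X ⟶ Spec (CommRingCat.of k)) :
    Function.Injective
      (fun f : {f : Spec (CommRingCat.of R) ⟶ X //
          f ≫ fX = Spec.map (CommRingCat.ofHom (algebraMap k R))} =>
        Spec.map (CommRingCat.ofHom
          (Algebra.TensorProduct.includeLeftRingHom : R →+* R ⊗[k] Ω)) ≫ f.val) := by
  intro f g h
  have hff : (algebraMap R (R ⊗[k] Ω)).FaithfullyFlat :=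
    RingHom.faithfullyFlat_algebraMap_iff.mpr inferInstance
  obtain ⟨_, _⟩ := (flat_and_surjective_SpecMap_iff (f := CommRingCat.ofHom
    (Algebra.TensorProduct.includeLeftRingHom : R →+* R ⊗[k] Ω))).mpr hff
  have : Epi (Spec.map (CommRingCat.ofHom
    (Algebra.TensorProduct.includeLeftRingHom : R →+* R ⊗[k] Ω))) :=
    Flat.epi_of_flat_of_surjective _
  exact Subtype.ext ((cancel_epi _).mp h)
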